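/- arXiv:2301.01654 — 2 statements merged into one kernel-verified Lean document; each statement's English description precedes it below -/
import Mathlib

section
/- Let a, b ∈ F× with a ≠ b, let γ = diag(a, a, b) ∈ GL₃(F), and let G_γ = {M ∈ GL₃(F) : Mγ = γM} be its centralizer. Then for every K-bi-invariant function f : GL₃(F) → ℂ (i.e. f(kxh) = f(x) for all k, h ∈ K and x ∈ GL₃(F)), one has (1/|G_γ|) · Σ_{s ∈ GL₃(F)} f(s⁻¹γs) = ((q³ − 1)/(q − 1)) · Σ_{x, y ∈ F} f([[a, 0, x], [0, a, y], [0, 0, b]]). -/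
open Matrix in
def osKmat {F : Type*} [Field F] (δ : F) (r : F × F × F) : Matrix (Fin 3) (Fin 3) F :=
  !![r.2.2, r.1 * δ, r.2.1 * δ; r.2.1, r.2.2, r.1 * δ; r.1, r.2.1, r.2.2]

open Polynomial in
theorem osKmat_det {F : Type*} [Field F] (δ : F) (hδ : ¬∃ x : F, x ^ 3 = δ)
    (r : F × F × F) (hr : r ≠ 0) : (osKmat δ r).det ≠ 0 := by
  obtain ⟨c, b, a⟩ := r
  have hirr : Irreducible (X ^ 3 - C δ : F[X]) :=
    X_pow_sub_C_irreducible_of_prime Nat.prime_three (fun x hx => hδ ⟨x, hx⟩)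
  set g : F[X] := C c * X ^ 2 + C b * X + C a with hg
  have hg0 : g ≠ 0 := by
    intro h
    apply hr
    have h0 : g.coeff 0 = 0 := by rw [h]; simp
    have h1 : g.coeff 1 = 0 := by rw [h]; simp
    have h2 : g.coeff 2 = 0 := by rw [h]; simp
    simp [hg, coeff_X, coeff_C] at h0 h1 h2
    simp [h0, h1, h2]
  have hcop : IsCoprime (X ^ 3 - C δ : F[X]) g := by
    rw [hirr.coprime_iff_not_dvd]
    intro hd
    have h1 := Polynomial.degree_le_of_dvd hd hg0
    rw [degree_X_pow_sub_C (by norm_num)] at h1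
    have h2 : g.degree ≤ 2 := degree_quadratic_le
    have := h1.trans h2
    exact absurd this (by decide)
  obtain ⟨u, v, huv⟩ := hcop
  let D : Matrix (Fin 3) (Fin 3) F := !![0, 0, δ; 1, 0, 0; 0, 1, 0]
  have hD : aeval D (X ^ 3 - C δ : F[X]) = 0 := by
    simp only [map_sub, map_pow, aeval_X, aeval_C]
    ext i j
    fin_cases i <;> fin_cases j <;>
      simp [D, pow_succ, Matrix.mul_apply, Fin.sum_univ_three, Matrix.algebraMap_matrix_apply]
  have hgD : aeval D g = osKmat δ (c, b, a) := by
    simp only [hg, map_add, map_mul, map_pow, aeval_X, aeval_C]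
    ext i j
    fin_cases i <;> fin_cases j <;>
      simp [D, osKmat, pow_succ, Matrix.mul_apply, Fin.sum_univ_three,
        Matrix.algebraMap_matrix_apply]
  have h := congrArg (aeval D) huv
  rw [map_add, map_mul, map_mul, hD, hgD, mul_zero, zero_add, map_one] at h
  intro h0
  have h' := congrArg Matrix.det h
  rw [Matrix.det_mul, h0] at h'
  simp at h'

/-- Elements of `K`, by their last row. -/
noncomputable def osK {F : Type*} [Field F] (δ : F) (hδ : ¬∃ x : F, x ^ 3 = δ)
    (r : {r : F × F × F // r ≠ 0}) : Matrix.GeneralLinearGroup (Fin 3) F :=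
  Matrix.GeneralLinearGroup.mkOfDetNeZero (osKmat δ r.1) (osKmat_det δ hδ r.1 r.2)

noncomputable def osU {F : Type*} [Field F] (x y : F) : Matrix.GeneralLinearGroup (Fin 3) F :=
  Matrix.GeneralLinearGroup.mkOfDetNeZero !![1, 0, x; 0, 1, y; 0, 0, 1]
    (by simp [Matrix.det_fin_three])

theorem osK_val {F : Type*} [Field F] (δ : F) (hδ : ¬∃ x : F, x ^ 3 = δ)
    (r : {r : F × F × F // r ≠ 0}) : (osK δ hδ r).val = osKmat δ r.1 := rfl

theorem osU_val {F : Type*} [Field F] (x y : F) :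
    (osU x y).val = !![1, 0, x; 0, 1, y; 0, 0, 1] := rfl

abbrev osC {F : Type*} [Field F] (a b : F) : Type _ :=
  {s : Matrix.GeneralLinearGroup (Fin 3) F //
    s.val * !![a, 0, 0; 0, a, 0; 0, 0, b] = !![a, 0, 0; 0, a, 0; 0, 0, b] * s.val}

theorem osC_entries {F : Type*} [Field F] {a b : F} (hab : a ≠ b) (s : osC a b) :
    s.1.val 0 2 = 0 ∧ s.1.val 1 2 = 0 ∧ s.1.val 2 0 = 0 ∧ s.1.val 2 1 = 0 := by
  have h := s.2
  have hab' : a - b ≠ 0 := sub_ne_zero.2 hab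
  have key : ∀ x : F, x * b = a * x → x = 0 := by
    intro x hx
    have : (a - b) * x = 0 := by linear_combination -hx
    exact (mul_eq_zero.1 this).resolve_left hab'
  have key2 : ∀ x : F, x * a = b * x → x = 0 := by
    intro x hx
    have : (a - b) * x = 0 := by linear_combination hx
    exact (mul_eq_zero.1 this).resolve_left hab'
  have e02 := congrFun (congrFun h 0) 2
  have e12 := congrFun (congrFun h 1) 2
  have e20 := congrFun (congrFun h 2) 0
  have e21 := congrFun (congrFun h 2) 1
  simp [Matrix.mul_apply, Fin.sum_univ_three] at e02 e12 e20 e21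
  refine ⟨key _ ?_, key _ ?_, key2 _ ?_, key2 _ ?_⟩ <;> simp [*]

theorem osC_ne {F : Type*} [Field F] {a b : F} (hab : a ≠ b) (s : osC a b) :
    s.1.val 2 2 ≠ 0 := by
  obtain ⟨h02, h12, h20, h21⟩ := osC_entries hab s
  intro h
  have hd : s.1.val.det = 0 := by
    rw [Matrix.det_fin_three, h02, h12, h]; ring
  exact ((Matrix.isUnit_iff_isUnit_det _).1 s.1.isUnit).ne_zero hd

/-- The parametrisation map. -/
noncomputable def osPhi {F : Type*} [Field F] (δ : F) (hδ : ¬∃ x : F, x ^ 3 = δ) {a b : F}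
    (hab : a ≠ b) (z : osC a b × (F × F) × {r : F × F × F // r ≠ 0}) :
    Matrix.GeneralLinearGroup (Fin 3) F × Fˣ :=
  (z.1.1 * osU z.2.1.1 z.2.1.2 * osK δ hδ z.2.2, Units.mk0 (z.1.1.val 2 2) (osC_ne hab z.1))

theorem osC_mul_U {F : Type*} [Field F] {a b : F} (hab : a ≠ b) (s : osC a b) (x y : F) :
    (s.1 * osU x y).val = !![s.1.val 0 0, s.1.val 0 1, s.1.val 0 0 * x + s.1.val 0 1 * y;
      s.1.val 1 0, s.1.val 1 1, s.1.val 1 0 * x + s.1.val 1 1 * y; 0, 0, s.1.val 2 2] := by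
  obtain ⟨h02, h12, h20, h21⟩ := osC_entries hab s
  rw [Units.val_mul, osU_val]
  ext i j
  fin_cases i <;> fin_cases j <;>
    simp [Matrix.mul_apply, Fin.sum_univ_three, h02, h12, h20, h21]

theorem osPhi_inj {F : Type*} [Field F] (δ : F) (hδ : ¬∃ x : F, x ^ 3 = δ) {a b : F}
    (hab : a ≠ b) : Function.Injective (osPhi δ hδ hab) := by
  rintro ⟨h, ⟨x, y⟩, k⟩ ⟨h', ⟨x', y'⟩, k'⟩ heq
  simp only [osPhi, Prod.mk.injEq] at heq
  obtain ⟨h1, h2⟩ := heq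
  have h22 : h.1.val 2 2 = h'.1.val 2 2 := congrArg Units.val h2
  have hne := osC_ne hab h'
  have hv : (h.1 * osU x y).val * osKmat δ k.1 = (h'.1 * osU x' y').val * osKmat δ k'.1 :=
    congrArg Units.val h1
  rw [osC_mul_U hab, osC_mul_U hab] at hv
  have e0 := congrFun (congrFun hv 2) 0
  have e1 := congrFun (congrFun hv 2) 1
  have e2 := congrFun (congrFun hv 2) 2
  simp [Matrix.mul_apply, Fin.sum_univ_three, osKmat, h22] at e0 e1 e2
  have hk : k = k' := by
    apply Subtype.ext
    refine Prod.ext ?_ (Prod.ext ?_ ?_)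
    · exact e0.resolve_right hne
    · exact e1.resolve_right hne
    · exact e2.resolve_right hne
  subst hk
  have h3 : h.1 * osU x y = h'.1 * osU x' y' := mul_right_cancel h1
  have h3v := congrArg Units.val h3
  rw [osC_mul_U hab, osC_mul_U hab] at h3v
  obtain ⟨p02, p12, p20, p21⟩ := osC_entries hab h
  obtain ⟨p02', p12', p20', p21'⟩ := osC_entries hab h'
  have hh : h = h' := by
    apply Subtype.ext
    apply Units.ext
    have f00 := congrFun (congrFun h3v 0) 0
    have f01 := congrFun (congrFun h3v 0) 1
    have f10 := congrFun (congrFun h3v 1) 0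
    have f11 := congrFun (congrFun h3v 1) 1
    simp at f00 f01 f10 f11
    ext i j
    fin_cases i <;> fin_cases j <;> simp [*]
  subst hh
  have h4 : osU x y = osU x' y' := mul_left_cancel h3
  have h4v := congrArg Units.val h4
  rw [osU_val, osU_val] at h4v
  have g0 := congrFun (congrFun h4v 0) 2
  have g1 := congrFun (congrFun h4v 1) 2
  simp at g0 g1
  simp [g0, g1]

open Matrix in
theorem osPhi_surj {F : Type*} [Field F] (δ : F) (hδ : ¬∃ x : F, x ^ 3 = δ) {a b : F}
    (hab : a ≠ b) : Function.Surjective (osPhi δ hδ hab) := by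
  rintro ⟨s, t⟩
  have sdet : s.val.det ≠ 0 := ((Matrix.isUnit_iff_isUnit_det _).1 s.isUnit).ne_zero
  have ht : (t : F) ≠ 0 := t.ne_zero
  let r : F × F × F := ((t : F)⁻¹ * s.val 2 0, (t : F)⁻¹ * s.val 2 1, (t : F)⁻¹ * s.val 2 2)
  have hr : r ≠ 0 := by
    intro h
    simp [r, Prod.ext_iff] at h
    apply sdet
    rw [Matrix.det_fin_three, h.1, h.2.1, h.2.2]; ring
  let k := osK δ hδ ⟨r, hr⟩
  have hkv : k.val = osKmat δ r := rfl
  let p := s * k⁻¹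
  have hpk : p * k = s := by simp [p]
  have pdet : p.val.det ≠ 0 := ((Matrix.isUnit_iff_isUnit_det _).1 p.isUnit).ne_zero
  -- last row of p
  have hrow : p.val 2 = ![0, 0, (t : F)] := by
    have e1 : (![0, 0, (t : F)] : Fin 3 → F) ᵥ* k.val = s.val 2 := by
      rw [hkv]
      ext j
      fin_cases j <;> simp [Matrix.vecMul, dotProduct, Fin.sum_univ_three, osKmat, r, ht]
    have e2 : s.val 2 ᵥ* k⁻¹.val = p.val 2 := by
      ext j
      simp [p, Matrix.mul_apply, Matrix.vecMul, dotProduct]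
    rw [← e2, ← e1, Matrix.vecMul_vecMul, ← Units.val_mul, mul_inv_cancel, Units.val_one,
      Matrix.vecMul_one]
  have h20 : p.val 2 0 = 0 := by rw [hrow]; rfl
  have h21 : p.val 2 1 = 0 := by rw [hrow]; rfl
  have h22 : p.val 2 2 = t := by rw [hrow]; rfl
  have hD : p.val 0 0 * p.val 1 1 - p.val 0 1 * p.val 1 0 ≠ 0 := by
    intro h
    apply pdet
    rw [Matrix.det_fin_three, h20, h21, h22]
    linear_combination (t : F) * h
  let h : Matrix.GeneralLinearGroup (Fin 3) F := Matrix.GeneralLinearGroup.mkOfDetNeZero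
    !![p.val 0 0, p.val 0 1, 0; p.val 1 0, p.val 1 1, 0; 0, 0, (t : F)] (by
      rw [Matrix.det_fin_three]
      simp
      rw [← sub_mul]
      exact mul_ne_zero hD ht)
  have hhv : h.val = !![p.val 0 0, p.val 0 1, 0; p.val 1 0, p.val 1 1, 0; 0, 0, (t : F)] := rfl
  have hC : h.val * !![a, 0, 0; 0, a, 0; 0, 0, b] = !![a, 0, 0; 0, a, 0; 0, 0, b] * h.val := by
    rw [hhv]
    ext i j
    fin_cases i <;> fin_cases j <;> simp [Matrix.mul_apply, Fin.sum_univ_three, mul_comm]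
  let x := (p.val 1 1 * p.val 0 2 - p.val 0 1 * p.val 1 2) /
    (p.val 0 0 * p.val 1 1 - p.val 0 1 * p.val 1 0)
  let y := (p.val 0 0 * p.val 1 2 - p.val 1 0 * p.val 0 2) /
    (p.val 0 0 * p.val 1 1 - p.val 0 1 * p.val 1 0)
  have hx : p.val 0 0 * x + p.val 0 1 * y = p.val 0 2 := by
    simp only [x, y]; rw [mul_div_assoc', mul_div_assoc', ← add_div, div_eq_iff hD]; ring
  have hy : p.val 1 0 * x + p.val 1 1 * y = p.val 1 2 := by
    simp only [x, y]; rw [mul_div_assoc', mul_div_assoc', ← add_div, div_eq_iff hD]; ring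
  have hp : h * osU x y = p := by
    apply Units.ext
    have := osC_mul_U hab ⟨h, hC⟩ x y
    simp only at this
    rw [this, hhv]
    ext i j
    fin_cases i <;> fin_cases j <;> simp [hx, hy, h20, h21, h22]
  refine ⟨(⟨h, hC⟩, (x, y), ⟨r, hr⟩), ?_⟩
  simp only [osPhi]
  refine Prod.ext ?_ (Units.ext ?_)
  · change h * osU x y * k = s
    rw [hp, hpk]
  · simp [hhv]


theorem orbital_sum_first_hyperbolic (F : Type*) [Field F] [Fintype F] [DecidableEq F]
    (δ : F) (hδ : ¬∃ x : F, x ^ 3 = δ) (q : ℕ) (hq : Fintype.card F = q)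
    (a b : F) (ha : a ≠ 0) (hb : b ≠ 0) (hab : a ≠ b)
    (f : Matrix (Fin 3) (Fin 3) F → ℂ)
    (hf : ∀ k h x : GL (Fin 3) F,
        (∃ a' b' c' : F, k.val = !![a', c' * δ, b' * δ; b', a', c' * δ; c', b', a']) →
        (∃ a' b' c' : F, h.val = !![a', c' * δ, b' * δ; b', a', c' * δ; c', b', a']) →
        f (k.val * x.val * h.val) = f x.val) :
    (1 / (Nat.card {s : GL (Fin 3) F //
          s.val * !![a, 0, 0; 0, a, 0; 0, 0, b] = !![a, 0, 0; 0, a, 0; 0, 0, b] * s.val} : ℂ)) *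
        ∑ s : GL (Fin 3) F, f (s⁻¹.val * !![a, 0, 0; 0, a, 0; 0, 0, b] * s.val) =
      (((q : ℂ) ^ 3 - 1) / ((q : ℂ) - 1)) *
        ∑ x : F, ∑ y : F, f !![a, 0, x; 0, a, y; 0, 0, b] := by
  classical
  have hab' : a - b ≠ 0 := sub_ne_zero.2 hab
  let γ : GL (Fin 3) F := Matrix.GeneralLinearGroup.mkOfDetNeZero
    !![a, 0, 0; 0, a, 0; 0, 0, b] (by simp [Matrix.det_fin_three, ha, hb])
  have hγ : !![a, 0, 0; 0, a, 0; 0, 0, b] = γ.val := rfl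
  have hone : ∃ a' b' c' : F, (1 : GL (Fin 3) F).val =
      !![a', c' * δ, b' * δ; b', a', c' * δ; c', b', a'] := by
    refine ⟨1, 0, 0, ?_⟩
    rw [Units.val_one]
    ext i j
    fin_cases i <;> fin_cases j <;> simp
  have hconj : ∀ z : osC a b × (F × F) × {r : F × F × F // r ≠ 0},
      f ((osPhi δ hδ hab z).1⁻¹.val * !![a, 0, 0; 0, a, 0; 0, 0, b] * (osPhi δ hδ hab z).1.val) =
      f !![a, 0, (a - b) * z.2.1.1; 0, a, (a - b) * z.2.1.2; 0, 0, b] := by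
    rintro ⟨h, ⟨x, y⟩, k⟩
    have hk : ∃ a' b' c' : F, (osK δ hδ k).val =
      !![a', c' * δ, b' * δ; b', a', c' * δ; c', b', a'] := ⟨_, _, _, rfl⟩
    have hc : h.1 * γ = γ * h.1 := Units.ext h.2
    let Y := (osU x y)⁻¹ * γ * osU x y
    have hY : Y.val = !![a, 0, (a - b) * x; 0, a, (a - b) * y; 0, 0, b] := by
      have e : γ.val * (osU x y).val =
          (osU x y).val * !![a, 0, (a - b) * x; 0, a, (a - b) * y; 0, 0, b] := by
        rw [← hγ, osU_val]
        ext i j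
        fin_cases i <;> fin_cases j <;>
          simp [Matrix.mul_apply, Fin.sum_univ_three] <;> ring
      change (osU x y)⁻¹.val * γ.val * (osU x y).val = _
      rw [mul_assoc, e, ← mul_assoc, ← Units.val_mul, inv_mul_cancel, Units.val_one, one_mul]
    let M := (osPhi δ hδ hab (h, (x, y), k)).1⁻¹ * γ * (osPhi δ hδ hab (h, (x, y), k)).1
    have hM : osK δ hδ k * M = Y * osK δ hδ k := by
      have hc' : h.1⁻¹ * γ * h.1 = γ := by rw [mul_assoc, ← hc]; group
      have : M = (osK δ hδ k)⁻¹ * ((osU x y)⁻¹ * (h.1⁻¹ * γ * h.1) * osU x y) * osK δ hδ k := by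
        simp only [M, osPhi]; group
      rw [this, hc']
      simp only [Y]; group
    have h1 := hf (osK δ hδ k) 1 M hk hone
    have h2 := hf 1 (osK δ hδ k) Y hone hk
    rw [← Units.val_mul, ← Units.val_mul, mul_one, hM] at h1
    rw [← Units.val_mul, ← Units.val_mul, one_mul] at h2
    change f M.val = _
    rw [← h1, h2, hY]
  have hbij : Function.Bijective (osPhi δ hδ hab) := ⟨osPhi_inj δ hδ hab, osPhi_surj δ hδ hab⟩
  have hq1 : 1 < q := hq ▸ Fintype.one_lt_card
  have hsum := hbij.sum_comp (fun w : GL (Fin 3) F × Fˣ =>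
    f (w.1⁻¹.val * !![a, 0, 0; 0, a, 0; 0, 0, b] * w.1.val))
  simp only [hconj] at hsum
  rw [Fintype.sum_prod_type, Fintype.sum_prod_type] at hsum
  simp only [Fintype.sum_prod_type, Finset.sum_const, Finset.card_univ, Fintype.card_units,
    nsmul_eq_mul, ← Finset.mul_sum, hq] at hsum
  have hcK : Fintype.card {r : F × F × F // r ≠ 0} = q ^ 3 - 1 := by
    rw [Fintype.card_subtype_compl, Fintype.card_subtype_eq]
    simp [hq, pow_succ, mul_assoc]
  have hre : ∑ x : F, ∑ y : F, f !![a, 0, (a - b) * x; 0, a, (a - b) * y; 0, 0, b] =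
      ∑ x : F, ∑ y : F, f !![a, 0, x; 0, a, y; 0, 0, b] := by
    rw [← (mulLeft_bijective₀ (a - b) hab').sum_comp
      (fun x => ∑ y : F, f !![a, 0, x; 0, a, y; 0, 0, b])]
    refine Finset.sum_congr rfl fun x _ => ?_
    rw [← (mulLeft_bijective₀ (a - b) hab').sum_comp
      (fun y => f !![a, 0, (a - b) * x; 0, a, y; 0, 0, b])]
  rw [hcK, hre, Nat.cast_sub (Nat.one_le_pow _ _ (by omega)), Nat.cast_sub hq1.le] at hsum
  have hC0 : (Fintype.card (osC a b) : ℂ) ≠ 0 := by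
    have : Nonempty (osC a b) := ⟨⟨1, by simp⟩⟩
    exact_mod_cast Fintype.card_ne_zero
  have hq0 : (q : ℂ) - 1 ≠ 0 := by
    rw [sub_ne_zero]; exact_mod_cast hq1.ne'
  rw [Nat.card_eq_fintype_card]
  rw [Nat.cast_pow, Nat.cast_one] at hsum
  change 1 / (Fintype.card (osC a b) : ℂ) * _ = _
  rw [div_mul_eq_mul_div, div_mul_eq_mul_div, div_eq_div_iff hC0 hq0]
  linear_combination -hsum
end

section
/- Let a ∈ F×, let γ = [[a, 0, a], [0, a, 0], [0, 0, a]] ∈ GL₃(F), and let G_γ = {M ∈ GL₃(F) : Mγ = γM} be its centralizer. Then for every K-bi-invariant function f : GL₃(F) → ℂ (i.e. f(kxh) = f(x) for all k, h ∈ K and x ∈ GL₃(F)), one has (1/|G_γ|) · Σ_{s ∈ GL₃(F)} f(s⁻¹γs) = (q² + q + 1) · ( Σ_{x, y ∈ F} f([[a, 0, ax], [0, a, ay], [0, 0, a]]) − f(a·I) ), where I is the identity matrix. -/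
open Matrix in
lemma aux_fibre {G β : Type*} [Fintype G] [DecidableEq β] (T : G → ℂ) (π : G → β) (b0 : β)
    (B : Finset β) (hB : ∀ g, T g ≠ 0 → π g ∈ B)
    (h : ∀ b ∈ B, ∃ k : G ≃ G, (∀ g, π (k g) = b ↔ π g = b0) ∧ ∀ g, T (k g) = T g) :
    ∑ g, T g = (B.card : ℂ) * ∑ g, if π g = b0 then T g else 0 := by
  have h1 : ∀ g, T g = ∑ b ∈ B, if π g = b then T g else 0 := by
    intro g
    rw [Finset.sum_ite_eq]
    by_cases h0 : T g = 0
    · simp [h0]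
    · simp [hB g h0]
  rw [Finset.sum_congr rfl (fun g _ => h1 g), Finset.sum_comm, ← nsmul_eq_mul]
  apply Finset.sum_eq_card_nsmul
  intro b hb
  obtain ⟨k, hk1, hk2⟩ := h b hb
  rw [← Equiv.sum_comp k]
  refine Finset.sum_congr rfl fun g _ => ?_
  simp only [hk1, hk2]

lemma aux_linear {F : Type*} [Field F] {δ : F} (hδ : ¬∃ x : F, x ^ 3 = δ) {a b : F}
    (h : a ^ 3 + b ^ 3 * δ = 0) : a = 0 ∧ b = 0 := by
  by_cases hb : b = 0
  · subst hb
    simpa using h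
  · exfalso
    apply hδ
    refine ⟨-a / b, ?_⟩
    field_simp
    linear_combination -h

lemma aux_norm {F : Type*} [Field F] {δ : F} (hδ : ¬∃ x : F, x ^ 3 = δ) {a b c : F}
    (h : a ^ 3 + b ^ 3 * δ + c ^ 3 * δ ^ 2 - 3 * a * b * c * δ = 0) :
    a = 0 ∧ b = 0 ∧ c = 0 := by
  by_cases hc : c = 0
  · subst hc
    have := aux_linear hδ (a := a) (b := b) (by linear_combination h)
    tauto
  · exfalso
    obtain ⟨h1, h2⟩ := aux_linear hδ (a := c ^ 2 * δ - a * b) (b := a * c - b ^ 2)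
      (by linear_combination (c ^ 3 * δ - b ^ 3) * h)
    apply hδ
    refine ⟨b / c, ?_⟩
    field_simp
    linear_combination (-b) * h2 - c * h1

open Matrix in
lemma aux_K {F : Type*} [Field F] [DecidableEq F] {δ : F} (hδ : ¬∃ x : F, x ^ 3 = δ)
    (r : Fin 3 → F) (hr : r ≠ 0) :
    ∃ k : GL (Fin 3) F,
      k.val = !![r 2, r 0 * δ, r 1 * δ; r 1, r 2, r 0 * δ; r 0, r 1, r 2] := by
  have hdet : (!![r 2, r 0 * δ, r 1 * δ; r 1, r 2, r 0 * δ; r 0, r 1, r 2]).det ≠ 0 := by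
    intro h
    rw [Matrix.det_fin_three] at h
    simp at h
    obtain ⟨h1, h2, h3⟩ := aux_norm hδ (a := r 2) (b := r 1) (c := r 0)
      (by linear_combination h)
    apply hr
    funext i
    fin_cases i <;> simp [h1, h2, h3]
  exact ⟨Matrix.GeneralLinearGroup.mkOfDetNeZero _ hdet, rfl⟩

open Matrix in
lemma aux_Kinv {F : Type*} [Field F] [DecidableEq F] {δ : F} (hδ : ¬∃ x : F, x ^ 3 = δ)
    (k : GL (Fin 3) F) (hk : ∃ a' b' c' : F, k.val = !![a', c' * δ, b' * δ; b', a', c' * δ; c', b', a']) :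
    ∃ a' b' c' : F, k⁻¹.val = !![a', c' * δ, b' * δ; b', a', c' * δ; c', b', a'] := by
  obtain ⟨a, b, c, hk⟩ := hk
  rw [Matrix.coe_units_inv, Matrix.inv_def, hk, Matrix.adjugate_fin_three]
  set d := Ring.inverse (Matrix.det !![a, c * δ, b * δ; b, a, c * δ; c, b, a])
  refine ⟨d * (a ^ 2 - b * c * δ), d * (c ^ 2 * δ - a * b), d * (b ^ 2 - a * c), ?_⟩
  ext i j
  fin_cases i <;> fin_cases j <;> simp [-mul_eq_mul_left_iff] <;> ring

open Matrix in
lemma aux_sum_K {F : Type*} [Field F] [Fintype F] [DecidableEq F] {δ : F}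
    (hδ : ¬∃ x : F, x ^ 3 = δ) (T : GL (Fin 3) F → ℂ)
    (hT : ∀ k s : GL (Fin 3) F,
      (∃ a' b' c' : F, k.val = !![a', c' * δ, b' * δ; b', a', c' * δ; c', b', a']) →
      T (s * k) = T s) :
    ∑ s, T s = ((Fintype.card F : ℂ) ^ 3 - 1) *
      ∑ s : GL (Fin 3) F, if s.val 2 = ![0, 0, 1] then T s else 0 := by
  have key := aux_fibre T (fun s : GL (Fin 3) F => s.val 2) ![0, 0, 1]
    (Finset.univ.erase (0 : Fin 3 → F)) ?_ ?_
  · rw [key, Finset.card_erase_of_mem (Finset.mem_univ _), Finset.card_univ]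
    congr 1
    rw [Nat.cast_pred Fintype.card_pos]
    simp
  · intro s _
    simp only [Finset.mem_erase, Finset.mem_univ, and_true]
    intro h
    have := (Matrix.isUnit_iff_isUnit_det _).1 s.isUnit
    rw [Matrix.det_eq_zero_of_row_eq_zero 2 (fun j => congrFun h j)] at this
    exact not_isUnit_zero this
  · intro r hr
    obtain ⟨k, hk⟩ := aux_K hδ r (by simpa using hr)
    refine ⟨Equiv.mulRight k, fun s => ?_, fun s => hT k s ⟨_, _, _, hk⟩⟩
    have e1 : (Equiv.mulRight k s).val 2 = (s.val 2) ᵥ* k.val := rfl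
    have e2 : ![0, 0, 1] ᵥ* k.val = r := by
      rw [hk]; funext i; fin_cases i <;> simp [Matrix.vecMul, dotProduct, Fin.sum_univ_three]
    simp only [e1]
    constructor
    · intro h
      exact Matrix.vecMul_injective_of_isUnit k.isUnit (h.trans e2.symm)
    · intro h; rw [h, e2]

open Matrix in
lemma aux_exists_p {F : Type*} [Field F] [DecidableEq F] (x y : F) (h : ¬ (x = 0 ∧ y = 0)) :
    ∃ p : GL (Fin 3) F, p.val 2 = ![0, 0, 1] ∧ p.val *ᵥ ![1, 0, 0] = ![x, y, 0] := by
  by_cases hx : x = 0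
  · have hy : y ≠ 0 := fun hy => h ⟨hx, hy⟩
    refine ⟨Matrix.GeneralLinearGroup.mkOfDetNeZero !![x, 1, 0; y, 0, 0; 0, 0, 1] ?_, rfl, ?_⟩
    · simp [Matrix.det_fin_three, hy]
    · funext i
      fin_cases i <;> simp [Matrix.GeneralLinearGroup.mkOfDetNeZero, Matrix.mulVec, dotProduct, Fin.sum_univ_three]
  · refine ⟨Matrix.GeneralLinearGroup.mkOfDetNeZero !![x, 0, 0; y, 1, 0; 0, 0, 1] ?_, rfl, ?_⟩
    · simp [Matrix.det_fin_three, hx]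
    · funext i
      fin_cases i <;> simp [Matrix.GeneralLinearGroup.mkOfDetNeZero, Matrix.mulVec, dotProduct, Fin.sum_univ_three]

open Matrix in
lemma aux_rowinv {F : Type*} [Field F] [DecidableEq F] (s : GL (Fin 3) F)
    (h : s.val 2 = ![0, 0, 1]) : s⁻¹.val 2 = ![0, 0, 1] := by
  have e : (s * s⁻¹).val 2 = s.val 2 ᵥ* s⁻¹.val := rfl
  have e3 : ![0, 0, 1] ᵥ* s⁻¹.val = s⁻¹.val 2 := by
    funext i; simp [Matrix.vecMul, dotProduct, Fin.sum_univ_three]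
  rw [h, e3, mul_inv_cancel] at e
  rw [← e]
  funext i; fin_cases i <;> simp

/-- Sum over the mirabolic subgroup. -/
lemma aux_sum_P {F : Type*} [Field F] [Fintype F] [DecidableEq F] (g : F → F → ℂ) :
    (∑ s : GL (Fin 3) F, if s.val 2 = ![0, 0, 1] then g (s.val 0 0) (s.val 1 0) else 0) =
    (∑ s : GL (Fin 3) F, if s.val 2 = ![0, 0, 1] ∧ s.val 0 0 = 1 ∧ s.val 1 0 = 0
      then (1 : ℂ) else 0) * ((∑ x, ∑ y, g x y) - g 0 0) := by
  set N := (∑ s : GL (Fin 3) F, if s.val 2 = ![0, 0, 1] ∧ s.val 0 0 = 1 ∧ s.val 1 0 = 0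
      then (1 : ℂ) else 0) with hN
  have h1 : ∀ s : GL (Fin 3) F, (if s.val 2 = ![0, 0, 1] then g (s.val 0 0) (s.val 1 0) else 0)
      = ∑ x, ∑ y, g x y * if s.val 2 = ![0, 0, 1] ∧ s.val 0 0 = x ∧ s.val 1 0 = y
        then (1 : ℂ) else 0 := by
    intro s
    by_cases hs : s.val 2 = ![0, 0, 1]
    · simp [hs, ite_and]
    · simp [hs]
  have h2 : ∀ x y : F, (∑ s : GL (Fin 3) F,
      if s.val 2 = ![0, 0, 1] ∧ s.val 0 0 = x ∧ s.val 1 0 = y then (1 : ℂ) else 0) =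
      N - if x = 0 then (if y = 0 then N else 0) else 0 := by
    intro x y
    by_cases hxy : x = 0 ∧ y = 0
    · obtain ⟨rfl, rfl⟩ := hxy
      simp only [if_true, sub_self]
      apply Finset.sum_eq_zero
      intro s _
      rw [if_neg]
      rintro ⟨h, h0, h1⟩
      have := (Matrix.isUnit_iff_isUnit_det _).1 s.isUnit
      rw [Matrix.det_eq_zero_of_column_eq_zero 0 (fun j => by
        fin_cases j
        · exact h0
        · exact h1
        · exact congrFun h 0)] at this
      exact not_isUnit_zero this
    · have : (if x = 0 then (if y = 0 then N else 0) else 0) = 0 := by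
        rw [← ite_and, if_neg hxy]
      rw [this, sub_zero, hN]
      obtain ⟨p, hp1, hp2⟩ := aux_exists_p x y hxy
      rw [← Equiv.sum_comp (Equiv.mulLeft p)]
      refine Finset.sum_congr rfl fun s _ => ?_
      have e1 : (Equiv.mulLeft p s).val 2 = s.val 2 := by
        have : (Equiv.mulLeft p s).val 2 = Matrix.vecMul (p.val 2) s.val := rfl
        rw [this, hp1]
        funext i; simp [Matrix.vecMul, dotProduct, Fin.sum_univ_three]
      have col : ∀ (M : GL (Fin 3) F) (u v : F), M.val 2 = ![0, 0, 1] →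
          ((M.val 0 0 = u ∧ M.val 1 0 = v) ↔ Matrix.mulVec M.val ![1, 0, 0] = ![u, v, 0]) := by
        intro M u v hM
        have : M.val 2 0 = 0 := by rw [hM]; rfl
        simp [Matrix.mulVec, dotProduct, Fin.sum_univ_three, funext_iff, Fin.forall_fin_succ, this]
      congr 1
      rw [e1]
      apply propext
      apply and_congr_right
      intro hs
      rw [col _ _ _ (e1.trans hs), col _ _ _ hs]
      have : (Equiv.mulLeft p s).val = p.val * s.val := rfl
      rw [this, ← Matrix.mulVec_mulVec, ← hp2]
      exact (Matrix.mulVec_injective_of_isUnit p.isUnit).eq_iff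
  rw [Finset.sum_congr rfl (fun s _ => h1 s), Finset.sum_comm]
  simp_rw [Finset.sum_comm (s := (Finset.univ : Finset (GL (Fin 3) F))), ← Finset.mul_sum, h2,
    mul_sub, Finset.sum_sub_distrib, ← Finset.sum_mul]
  simp
  ring

lemma aux_card {F : Type*} [Field F] [Fintype F] [DecidableEq F] (a : F) (ha : a ≠ 0) :
    (Nat.card {s : GL (Fin 3) F //
          s.val * !![a, 0, a; 0, a, 0; 0, 0, a] = !![a, 0, a; 0, a, 0; 0, 0, a] * s.val} : ℂ) =
    ((Fintype.card F : ℂ) - 1) *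
    (∑ s : GL (Fin 3) F, if s.val 2 = ![0, 0, 1] ∧ s.val 0 0 = 1 ∧ s.val 1 0 = 0
      then (1 : ℂ) else 0) := by
  have hc : ∀ M : Matrix (Fin 3) (Fin 3) F,
      (M * !![a, 0, a; 0, a, 0; 0, 0, a] = !![a, 0, a; 0, a, 0; 0, 0, a] * M) ↔
      (M 2 0 = 0 ∧ M 2 1 = 0 ∧ M 1 0 = 0 ∧ M 0 0 = M 2 2) := by
    intro M
    constructor
    · intro h
      have h' := fun i j => congrFun (congrFun h i) j
      have h00 := h' 0 0
      have h01 := h' 0 1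
      have h02 := h' 0 2
      have h12 := h' 1 2
      simp [Matrix.mul_apply, Fin.sum_univ_three] at h00 h01 h02 h12
      refine ⟨?_, ?_, ?_, ?_⟩
      · apply mul_left_cancel₀ ha; linear_combination -h00
      · apply mul_left_cancel₀ ha; linear_combination -h01
      · apply mul_left_cancel₀ ha; linear_combination h12
      · apply mul_left_cancel₀ ha; linear_combination h02
    · rintro ⟨h1, h2, h3, h4⟩
      ext i j
      fin_cases i <;> fin_cases j <;>
        simp [Matrix.mul_apply, Fin.sum_univ_three, h1, h2, h3, h4] <;> ring
  have key := aux_fibre (fun s : GL (Fin 3) F =>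
    if s.val 2 0 = 0 ∧ s.val 2 1 = 0 ∧ s.val 1 0 = 0 ∧ s.val 0 0 = s.val 2 2 then (1 : ℂ) else 0)
    (fun s => s.val 2 2) 1 (Finset.univ.erase (0 : F)) ?_ ?_
  · simp_rw [hc]
    rw [Nat.card_eq_fintype_card, Fintype.card_subtype, Finset.natCast_card_filter, key,
      Finset.card_erase_of_mem (Finset.mem_univ _), Finset.card_univ,
      Nat.cast_pred Fintype.card_pos]
    congr 1
    refine Finset.sum_congr rfl fun s _ => ?_
    rw [← ite_and]
    congr 1
    apply propext
    simp [funext_iff, Fin.forall_fin_succ]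
    constructor
    · rintro ⟨h, h1, h2, h3, h4⟩
      simp_all
    · rintro ⟨⟨h1, h2, h3⟩, h4, h5⟩
      simp_all
  · intro s hs
    simp only [ne_eq, ite_eq_right_iff, one_ne_zero, imp_false, not_not] at hs
    simp only [Finset.mem_erase, Finset.mem_univ, and_true]
    intro h
    have := (Matrix.isUnit_iff_isUnit_det _).1 s.isUnit
    rw [Matrix.det_eq_zero_of_row_eq_zero 2 (fun j => by
        fin_cases j
        · exact hs.1
        · exact hs.2.1
        · exact h)] at this
    exact not_isUnit_zero this
  · intro l hl
    have hl : l ≠ 0 := by simpa using hl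
    have hd : (l • (1 : Matrix (Fin 3) (Fin 3) F)).det ≠ 0 := by
      simp [Matrix.det_smul, hl]
    refine ⟨Equiv.mulLeft (Matrix.GeneralLinearGroup.mkOfDetNeZero _ hd), ?_, ?_⟩
    all_goals
      intro s
      have e : ∀ i j, (Equiv.mulLeft (Matrix.GeneralLinearGroup.mkOfDetNeZero _ hd) s).val i j
          = l * s.val i j := by
        intro i j
        have : (Equiv.mulLeft (Matrix.GeneralLinearGroup.mkOfDetNeZero _ hd) s).val
          = (l • (1 : Matrix (Fin 3) (Fin 3) F)) * s.val := rfl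
        rw [this]; simp
      simp [e, hl]


theorem orbital_sum_first_parabolic (F : Type*) [Field F] [Fintype F] [DecidableEq F]
    (δ : F) (hδ : ¬∃ x : F, x ^ 3 = δ) (q : ℕ) (hq : Fintype.card F = q)
    (a : F) (ha : a ≠ 0)
    (f : Matrix (Fin 3) (Fin 3) F → ℂ)
    (hf : ∀ k h x : GL (Fin 3) F,
        (∃ a' b' c' : F, k.val = !![a', c' * δ, b' * δ; b', a', c' * δ; c', b', a']) →
        (∃ a' b' c' : F, h.val = !![a', c' * δ, b' * δ; b', a', c' * δ; c', b', a']) →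
        f (k.val * x.val * h.val) = f x.val) :
    (1 / (Nat.card {s : GL (Fin 3) F //
          s.val * !![a, 0, a; 0, a, 0; 0, 0, a] = !![a, 0, a; 0, a, 0; 0, 0, a] * s.val} : ℂ)) *
        ∑ s : GL (Fin 3) F, f (s⁻¹.val * !![a, 0, a; 0, a, 0; 0, 0, a] * s.val) =
      ((q : ℂ) ^ 2 + (q : ℂ) + 1) *
        ((∑ x : F, ∑ y : F, f !![a, 0, a * x; 0, a, a * y; 0, 0, a]) -
          f (a • (1 : Matrix (Fin 3) (Fin 3) F))) := by
  have hconj : ∀ s : GL (Fin 3) F, ∃ t : GL (Fin 3) F,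
      t.val = s⁻¹.val * !![a, 0, a; 0, a, 0; 0, 0, a] * s.val := by
    intro s
    have hd : (!![a, 0, a; 0, a, 0; 0, 0, a]).det ≠ 0 := by
      simp [Matrix.det_fin_three, ha]
    exact ⟨s⁻¹ * Matrix.GeneralLinearGroup.mkOfDetNeZero _ hd * s, rfl⟩
  have h1 := aux_sum_K hδ
    (fun s : GL (Fin 3) F => f (s⁻¹.val * !![a, 0, a; 0, a, 0; 0, 0, a] * s.val)) (by
      intro k s hk
      obtain ⟨t, ht⟩ := hconj s
      have := hf k⁻¹ k t (aux_Kinv hδ k hk) hk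
      rw [ht] at this
      rw [← this]
      congr 1
      simp only [mul_inv_rev, Units.val_mul, Matrix.mul_assoc])
  have h2 : (∑ s : GL (Fin 3) F, if s.val 2 = ![0, 0, 1] then
      f (s⁻¹.val * !![a, 0, a; 0, a, 0; 0, 0, a] * s.val) else 0) =
      ∑ s : GL (Fin 3) F, if s.val 2 = ![0, 0, 1] then
        (fun x y => f !![a, 0, a * x; 0, a, a * y; 0, 0, a]) (s.val 0 0) (s.val 1 0) else 0 := by
    rw [← Equiv.sum_comp (Equiv.inv (GL (Fin 3) F))]
    refine Finset.sum_congr rfl fun s _ => ?_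
    have hiff : (Equiv.inv (GL (Fin 3) F) s).val 2 = ![0, 0, 1] ↔ s.val 2 = ![0, 0, 1] :=
      ⟨fun h => by simpa using aux_rowinv _ h, aux_rowinv s⟩
    simp only [hiff]
    by_cases hs : s.val 2 = ![0, 0, 1]
    swap
    · rw [if_neg hs, if_neg hs]
    rw [if_pos hs, if_pos hs]
    congr 1
    have e1 : (Equiv.inv (GL (Fin 3) F) s)⁻¹.val = s.val := by simp
    have e2 : (Equiv.inv (GL (Fin 3) F) s).val = s⁻¹.val := rfl
    rw [e1, e2]
    have e3 : s.val * s⁻¹.val = 1 := Units.mul_inv s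
    have h20 : s.val 2 0 = 0 := by rw [hs]; rfl
    have h21 : s.val 2 1 = 0 := by rw [hs]; rfl
    have h22 : s.val 2 2 = 1 := by rw [hs]; rfl
    have e4 : s.val * !![a, 0, a; 0, a, 0; 0, 0, a] =
        !![a, 0, a * s.val 0 0; 0, a, a * s.val 1 0; 0, 0, a] * s.val := by
      ext i j
      fin_cases i <;> fin_cases j <;>
        simp [Matrix.mul_apply, Fin.sum_univ_three, h20, h21, h22] <;> ring
    rw [e4, Matrix.mul_assoc, e3, Matrix.mul_one]
  have h3 := h2.trans (aux_sum_P (fun x y => f !![a, 0, a * x; 0, a, a * y; 0, 0, a]))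
  rw [h1, h3, aux_card a ha, hq]
  have hs : !![a, 0, a * 0; 0, a, a * 0; 0, 0, a] = a • (1 : Matrix (Fin 3) (Fin 3) F) := by
    ext i j
    fin_cases i <;> fin_cases j <;> simp
  simp only [hs]
  set N := (∑ s : GL (Fin 3) F, if s.val 2 = ![0, 0, 1] ∧ s.val 0 0 = 1 ∧ s.val 1 0 = 0
      then (1 : ℂ) else 0) with hN
  have hN0 : N ≠ 0 := by
    rw [hN, ← Finset.natCast_card_filter, Nat.cast_ne_zero, Finset.card_ne_zero]
    refine ⟨1, ?_⟩
    simp [funext_iff, Fin.forall_fin_succ]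
  have hq1 : (q : ℂ) - 1 ≠ 0 := by
    have : 1 < Fintype.card F := Fintype.one_lt_card
    rw [hq] at this
    rw [sub_ne_zero]
    exact_mod_cast this.ne'
  field_simp
  ring
end
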